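/- A cubic graph is matching covered if and only if it is 2-connected. -/

import Mathlib

open SimpleGraph

/-- A graph is cubic if every vertex has degree 3. -/
def IsCubic {V : Type*} (G : SimpleGraph V) : Prop :=
  ∀ v : V, (G.neighborSet v).ncard = 3

/-- A 2-factor of `G` is a 2-regular spanning subgraph of `G`. -/
def IsTwoFactor {V : Type*} (G : SimpleGraph V) (H : G.Subgraph) : Prop :=
  H.IsSpanning ∧ ∀ v : V, (H.neighborSet v).ncard = 2

/-- A graph is 2-factor Hamiltonian if every 2-factor of it is a Hamiltonian cycle,
i.e. a connected 2-regular spanning subgraph. -/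
def IsTwoFactorHamiltonian {V : Type*} (G : SimpleGraph V) : Prop :=
  ∀ H : G.Subgraph, IsTwoFactor G H → H.Connected

/-- A brace is a connected bipartite graph on at least four vertices in which every
matching of size at most two is contained in a perfect matching. -/
def IsBrace {V : Type*} (G : SimpleGraph V) : Prop :=
  G.Connected ∧ G.Colorable 2 ∧ 4 ≤ Nat.card V ∧
    ∀ M : G.Subgraph, M.IsMatching → M.edgeSet.ncard ≤ 2 →
      ∃ P : G.Subgraph, M ≤ P ∧ P.IsPerfectMatching

/-- The Heawood graph, as the point-line incidence graph of the Fano plane: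
points and lines are indexed by `Fin 7`, and point `p` lies on line `l` iff
`p + l ∈ {0, 1, 3}` (mod 7), `{0,1,3}` being a planar difference set mod 7. -/
def heawoodGraph : SimpleGraph (Fin 7 ⊕ Fin 7) :=
  SimpleGraph.fromRel fun a b => ∃ p l : Fin 7,
    a = Sum.inl p ∧ b = Sum.inr l ∧ (p + l = 0 ∨ p + l = 1 ∨ p + l = 3)

/-- A cycle (given as a closed walk) alternates between edges of the subgraph `M`
and edges not in `M`; the wrap-around pair is included by appending the first edge. -/
def IsAlternatingCycle {V : Type*} {G : SimpleGraph V} (M : G.Subgraph) {v : V}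
    (p : G.Walk v v) : Prop :=
  p.IsCycle ∧
    List.Chain' (fun e f => e ∈ M.edgeSet ↔ f ∉ M.edgeSet) (p.edges ++ p.edges.take 1)

/-- `σ` is a Pfaffian orientation of `G`: it orients every edge (exactly one direction),
and for every perfect matching `M` and every `M`-alternating cycle, the number of
its edges oriented in agreement with the direction of traversal is odd. -/
def IsPfaffianOrientation {V : Type*} (G : SimpleGraph V) (σ : V → V → Bool) : Prop :=
  (∀ u v : V, G.Adj u v → σ u v = !σ v u) ∧
  ∀ M : G.Subgraph, M.IsPerfectMatching →
    ∀ (v : V) (p : G.Walk v v), IsAlternatingCycle M p →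
      Odd (p.darts.filter fun d => σ d.toProd.1 d.toProd.2).length

/-- A graph with a perfect matching is Pfaffian if it admits a Pfaffian orientation. -/
def IsPfaffian {V : Type*} (G : SimpleGraph V) : Prop :=
  (∃ M : G.Subgraph, M.IsPerfectMatching) ∧ ∃ σ : V → V → Bool, IsPfaffianOrientation G σ

/-- The cut `∂X`: the set of edges of `G` with exactly one endpoint in `X`. -/
def edgeCut {V : Type*} (G : SimpleGraph V) (X : Set V) : Set (Sym2 V) :=
  {e | e ∈ G.edgeSet ∧ ∃ u w : V, e = s(u, w) ∧ u ∈ X ∧ w ∉ X}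

/-- A cut `∂X` is tight if every perfect matching contains exactly one of its edges. -/
def IsTightCut {V : Type*} (G : SimpleGraph V) (X : Set V) : Prop :=
  ∀ M : G.Subgraph, M.IsPerfectMatching → (edgeCut G X ∩ M.edgeSet).ncard = 1

/-- A cut `∂X` is trivial if `|X| = 1` or `|V(G) \ X| = 1`. -/
def IsTrivialCut {V : Type*} (X : Set V) : Prop :=
  X.ncard = 1 ∨ (Xᶜ : Set V).ncard = 1

/-- The tight cut contraction keeping `X`: contract `V(G) \ X` into a single vertex
(`Sum.inr ()`), deleting loops and parallel edges. -/
def contractOutside {V : Type*} (G : SimpleGraph V) (X : Set V) :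
    SimpleGraph (↥X ⊕ Unit) :=
  SimpleGraph.fromRel fun a b =>
    (∃ u v : X, a = Sum.inl u ∧ b = Sum.inl v ∧ G.Adj u v) ∨
    (∃ (u : X) (w : V), w ∉ X ∧ a = Sum.inl u ∧ b = Sum.inr () ∧ G.Adj u w)

/-- A graph is `k`-connected if it has more than `k` vertices and deleting any set of
fewer than `k` vertices leaves it connected. -/
def IsKConnected {V : Type*} (k : ℕ) (G : SimpleGraph V) : Prop :=
  k < Nat.card V ∧ ∀ S : Set V, S.ncard < k → (G.induce (Sᶜ : Set V)).Connected

/-- A graph is matching covered if it is connected, has an edge, and every edge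
lies in a perfect matching. -/
def IsMatchingCovered {V : Type*} (G : SimpleGraph V) : Prop :=
  G.Connected ∧ G.edgeSet.Nonempty ∧
    ∀ e ∈ G.edgeSet, ∃ M : G.Subgraph, M.IsPerfectMatching ∧ e ∈ M.edgeSet

/-- A graph is bridgeless if no edge is a bridge. -/
def Bridgeless {V : Type*} (G : SimpleGraph V) : Prop :=
  ∀ e : Sym2 V, ¬ G.IsBridge e

/-- `(A, B)` is a bipartition of `G` into the two colour classes `A` and `B`. -/
def IsBipartition {V : Type*} (G : SimpleGraph V) (A B : Set V) : Prop :=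
  A ∪ B = Set.univ ∧ Disjoint A B ∧
    ∀ u v : V, G.Adj u v → ((u ∈ A ∧ v ∈ B) ∨ (u ∈ B ∧ v ∈ A))

/-- `G` is the star product `(G1,v1)*(G2,v2)`, witnessed by the embeddings `f` of
`G1 - v1` and `g` of `G2 - v2` into `G`, and the bijection `m` matching the three
neighbours of `v1` to the three neighbours of `v2`: `v1` and `v2` have degree 3,
the images of `f` and `g` partition the vertices of `G`, and the edges of `G` are
exactly the edges of `G1 - v1`, the edges of `G2 - v2`, and the three matching edges
`f x — g (m x)` for `x` a neighbour of `v1`. -/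
def IsStarProductWitness {V V1 V2 : Type*} (G : SimpleGraph V)
    (G1 : SimpleGraph V1) (v1 : V1) (G2 : SimpleGraph V2) (v2 : V2)
    (f : V1 → V) (g : V2 → V) (m : V1 → V2) : Prop :=
  (G1.neighborSet v1).ncard = 3 ∧ (G2.neighborSet v2).ncard = 3 ∧
  Set.InjOn f {x | x ≠ v1} ∧ Set.InjOn g {y | y ≠ v2} ∧
  (∀ x y, x ≠ v1 → y ≠ v2 → f x ≠ g y) ∧
  (∀ v : V, (∃ x, x ≠ v1 ∧ f x = v) ∨ (∃ y, y ≠ v2 ∧ g y = v)) ∧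
  Set.BijOn m (G1.neighborSet v1) (G2.neighborSet v2) ∧
  (∀ a b : V, G.Adj a b ↔
    ((∃ x y, x ≠ v1 ∧ y ≠ v1 ∧ G1.Adj x y ∧ a = f x ∧ b = f y) ∨
     (∃ x y, x ≠ v2 ∧ y ≠ v2 ∧ G2.Adj x y ∧ a = g x ∧ b = g y) ∨
     (∃ x, G1.Adj v1 x ∧ ((a = f x ∧ b = g (m x)) ∨ (b = f x ∧ a = g (m x))))))

/-- `G` is a star product `(G1,v1)*(G2,v2)`. -/
def IsStarProduct {V V1 V2 : Type*} (G : SimpleGraph V)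
    (G1 : SimpleGraph V1) (v1 : V1) (G2 : SimpleGraph V2) (v2 : V2) : Prop :=
  ∃ (f : V1 → V) (g : V2 → V) (m : V1 → V2),
    IsStarProductWitness G G1 v1 G2 v2 f g m

/-- The principal 3-edge cut of a star product: the three added matching edges. -/
def principalCut {V V1 V2 : Type*} (G1 : SimpleGraph V1) (v1 : V1)
    (f : V1 → V) (g : V2 → V) (m : V1 → V2) : Set (Sym2 V) :=
  {e | ∃ x, G1.Adj v1 x ∧ e = s(f x, g (m x))}

open Finset in
/-- The number of ordered pairs of adjacent vertices inside a vertex set is even. -/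
theorem SimpleGraph.even_card_interedges_self {V : Type*} [DecidableEq V]
    (G : SimpleGraph V) [DecidableRel G.Adj] (K : Finset V) :
    Even #(G.interedges K K) := by
  rw [← ZMod.natCast_eq_zero_iff_even, Finset.cast_card]
  refine Finset.sum_involution (fun p _ ↦ p.swap) (fun _ _ ↦ by decide) ?_ ?_ ?_
  · rintro ⟨a, b⟩ h - hab
    simp only [G.mem_interedges_iff, Prod.swap_prod_mk, Prod.mk.injEq] at h hab
    exact h.2.2.ne hab.2
  · rintro ⟨a, b⟩ h
    simp only [G.mem_interedges_iff, Prod.swap_prod_mk] at h ⊢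
    exact ⟨h.2.1, h.1, h.2.2.symm⟩
  · simp

open Finset in
/-- Splitting the pairs of adjacent vertices with first coordinate in `A` according to whether the
second coordinate lies in `B`. -/
theorem SimpleGraph.card_interedges_add_compl {V : Type*} [Fintype V] [DecidableEq V]
    (G : SimpleGraph V) [DecidableRel G.Adj] (A B : Finset V) :
    #(G.interedges A B) + #(G.interedges A Bᶜ) = #(G.interedges A univ) := by
  rw [← card_union_of_disjoint (s := G.interedges A B) (t := G.interedges A Bᶜ)
    (Rel.interedges_disjoint_right _ _ disjoint_compl_right)]
  congr 1
  ext ⟨a, b⟩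
  simp only [mem_union, G.mem_interedges_iff, mem_compl, mem_univ]
  tauto

open Finset in
theorem IsCubic.card_interedges_univ {V : Type*} [Fintype V] [DecidableEq V]
    {G : SimpleGraph V} [DecidableRel G.Adj] (hG : IsCubic G) (A : Finset V) :
    #(G.interedges A univ) = 3 * #A := by
  have key : ∀ a ∈ A, ∑ b : V, (if G.Adj a b then 1 else 0) = 3 := by
    intro a _
    rw [← card_filter, ← hG a, ← Set.ncard_coe_finset]
    congr 1
    ext b
    simp
  rw [G.interedges_def, card_filter, sum_product, sum_congr rfl key]
  simp [mul_comm]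

theorem IsCubic.even_card {V : Type*} [Fintype V] {G : SimpleGraph V} (hG : IsCubic G) :
    Even (Fintype.card V) := by
  classical
  have h := G.even_card_interedges_self Finset.univ
  rw [hG.card_interedges_univ, Finset.card_univ] at h
  exact (Nat.even_mul.mp h).resolve_left (by decide)

/-- In a preconnected graph some edge leaves every proper nonempty vertex set. -/
theorem SimpleGraph.Preconnected.exists_adj_mem_notMem {V : Type*} {G : SimpleGraph V}
    (hG : G.Preconnected) {C : Set V} {a b : V} (ha : a ∈ C) (hb : b ∉ C) :
    ∃ x ∈ C, ∃ y ∉ C, G.Adj x y := by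
  obtain ⟨p⟩ := hG a b
  obtain ⟨d, -, h₁, h₂⟩ := p.exists_boundary_dart C ha hb
  exact ⟨d.fst, h₁, d.snd, h₂, d.adj⟩

open Finset in
/-- In a cubic graph without cut vertices, at least three edges leave any odd vertex set. -/
theorem IsCubic.three_le_card_interedges_compl {V : Type*} [Fintype V] [DecidableEq V]
    {G : SimpleGraph V} [DecidableRel G.Adj] (hG : IsCubic G)
    (hconn : ∀ v : V, (G.induce ({v}ᶜ : Set V)).Connected) {K : Finset V} (hK : Odd #K) :
    3 ≤ #(G.interedges K Kᶜ) := by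
  have hsum := G.card_interedges_add_compl K K
  rw [hG.card_interedges_univ] at hsum
  have heven := G.even_card_interedges_self K
  have hodd : Odd #(G.interedges K Kᶜ) := by grind
  suffices #(G.interedges K Kᶜ) ≠ 1 by
    obtain ⟨k, hk⟩ := hodd
    lia
  intro h1
  obtain ⟨⟨a, b⟩, hab⟩ := card_eq_one.mp h1
  have hmem : (a, b) ∈ G.interedges K Kᶜ := by simp [hab]
  simp only [G.mem_interedges_iff, mem_compl] at hmem
  obtain ⟨ha, hb, hadj⟩ := hmem
  obtain ⟨c, hc, hca⟩ : ∃ c ∈ K, c ≠ a := by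
    by_contra! hcon
    have hKa : K = {a} := by
      ext x
      exact ⟨fun hx ↦ by simp [hcon x hx], fun hx ↦ by simpa [mem_singleton.mp hx] using ha⟩
    have h0 : #(G.interedges K K) = 0 := by
      rw [card_eq_zero, eq_empty_iff_forall_notMem]
      rintro ⟨x, y⟩ hxy
      simp only [G.mem_interedges_iff, hKa, mem_singleton] at hxy
      obtain ⟨rfl, rfl, h⟩ := hxy
      exact G.irrefl h
    have h1' : #K = 1 := by simp [hKa]
    lia
  obtain ⟨x, hx, y, hy, hxy⟩ := (hconn a).preconnected.exists_adj_mem_notMem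
    (C := {z | z.1 ∈ K}) (a := ⟨c, hca⟩) (b := ⟨b, hadj.ne'⟩) hc hb
  have hmem : (x.1, y.1) ∈ G.interedges K Kᶜ := by
    simpa [G.mem_interedges_iff] using ⟨hx, hy, hxy⟩
  rw [hab, mem_singleton, Prod.mk.injEq] at hmem
  exact x.2 hmem.1

open Finset in
/-- If `S` contains an edge of a cubic graph, then few disjoint sets can each send three edges
to `S`. -/
theorem IsCubic.three_mul_card_add_two_le {V ι : Type*} [Fintype V] [DecidableEq V] [Fintype ι]
    {G : SimpleGraph V} [DecidableRel G.Adj] (hG : IsCubic G) {S : Finset V} {x y : V}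
    (hx : x ∈ S) (hy : y ∈ S) (hxy : G.Adj x y) {K : ι → Finset V}
    (hdisj : Pairwise fun i j ↦ Disjoint (K i) (K j)) (hKS : ∀ i, Disjoint (K i) S)
    (hK : ∀ i, 3 ≤ #(G.interedges (K i) S)) :
    3 * Fintype.card ι + 2 ≤ 3 * #S := by
  have hSS : 2 ≤ #(G.interedges S S) := by
    have hsub : {(x, y), (y, x)} ⊆ G.interedges S S := by
      intro p hp
      simp only [mem_insert, mem_singleton] at hp
      obtain rfl | rfl := hp
      · exact G.mem_interedges_iff.mpr ⟨hx, hy, hxy⟩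
      · exact G.mem_interedges_iff.mpr ⟨hy, hx, hxy.symm⟩
    refine le_trans (le_of_eq ?_) (card_le_card hsub)
    rw [card_pair]
    simp [hxy.ne]
  have hout : 3 * Fintype.card ι ≤ #(G.interedges Sᶜ S) := by
    calc 3 * Fintype.card ι = ∑ _i : ι, 3 := by simp [mul_comm]
      _ ≤ ∑ i, #(G.interedges (K i) S) := sum_le_sum fun i _ ↦ hK i
      _ = #(univ.biUnion fun i ↦ G.interedges (K i) S) :=
        (card_biUnion fun i _ j _ hij ↦ Rel.interedges_disjoint_left _ (hdisj hij) _).symm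
      _ ≤ #(G.interedges Sᶜ S) := card_le_card <| biUnion_subset.mpr fun i _ ↦
        Rel.interedges_mono (subset_compl_iff_disjoint_right.mpr (hKS i)) subset_rfl
  have hcomm : #(G.interedges Sᶜ S) = #(G.interedges S Sᶜ) :=
    have : Std.Symm G.Adj := ⟨fun _ _ ↦ .symm⟩
    Rel.card_interedges_comm _ _
  have hsum := G.card_interedges_add_compl S S
  rw [hG.card_interedges_univ] at hsum
  lia

open Finset in
/-- Tutte's theorem for graphs of even order, with the odd components given as vertex sets: if there
is no perfect matching, then deleting some `u` leaves at least `#u + 2` odd components. -/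
theorem SimpleGraph.IsMatchingFree.exists_odd_family.{u} {V : Type u} [Fintype V]
    {G : SimpleGraph V} (h : G.IsMatchingFree) (heven : Even (Fintype.card V)) :
    ∃ (u : Finset V) (ι : Type u) (_ : Fintype ι) (K : ι → Finset V),
      #u + 2 ≤ Fintype.card ι ∧ (Pairwise fun i j ↦ Disjoint (K i) (K j)) ∧
      (∀ i, Disjoint (K i) u) ∧ (∀ i, Odd #(K i)) ∧
      ∀ i, ∀ a ∈ K i, ∀ b, G.Adj a b → b ∈ K i ∨ b ∈ u := by
  classical
  obtain ⟨s, hs⟩ := exists_isTutteViolator h (by rwa [Nat.card_eq_fintype_card])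
  set H := ((⊤ : G.Subgraph).deleteVerts s).coe
  have hcard : Nat.card ((⊤ : G.Subgraph).deleteVerts s).verts + s.ncard = Fintype.card V := by
    rw [Nat.card_coe_set_eq, Subgraph.deleteVerts_verts, Subgraph.verts_top,
      ← Nat.card_eq_fintype_card, ← Set.ncard_univ]
    exact Set.ncard_sdiff_add_ncard_of_subset (Set.subset_univ s)
  have hpar := H.odd_ncard_oddComponents
  have hlt : s.ncard < H.oddComponents.ncard := hs
  refine ⟨s.toFinset, H.oddComponents, inferInstance, fun c ↦ (Subtype.val '' c.1.supp).toFinset,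
    ?_, ?_, ?_, ?_, ?_⟩
  · rw [← Set.ncard_eq_toFinset_card', ← Nat.card_eq_fintype_card, Nat.card_coe_set_eq]
    grind
  · intro c d hcd
    rw [Set.disjoint_toFinset, Set.disjoint_image_iff Subtype.val_injective]
    exact pairwise_disjoint_supp_connectedComponent _ fun h ↦ hcd (Subtype.ext h)
  · intro c
    rw [Set.disjoint_toFinset, Set.disjoint_left]
    rintro _ ⟨z, -, rfl⟩
    exact z.2.2
  · intro c
    rw [← Set.ncard_eq_toFinset_card', Set.ncard_image_of_injective _ Subtype.val_injective]
    exact c.2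
  · intro c a ha b hab
    simp only [Set.mem_toFinset] at ha ⊢
    obtain ⟨z, hz, rfl⟩ := ha
    by_cases hb : b ∈ s
    · exact .inr hb
    · refine .inl ⟨⟨b, by simp [hb]⟩, ?_, rfl⟩
      refine c.1.mem_supp_of_adj_mem_supp hz ?_
      have hz2 := z.2.2
      simp [H, hab, hz2, hb]

/-- A perfect matching of the graph obtained by deleting the ends of an edge extends to a perfect
matching containing that edge. -/
theorem SimpleGraph.Subgraph.IsPerfectMatching.exists_extend_edge {V : Type*} {G : SimpleGraph V}
    {x y : V} (hxy : G.Adj x y) {M : (G.induce ({x, y}ᶜ : Set V)).Subgraph}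
    (hM : M.IsPerfectMatching) :
    ∃ N : G.Subgraph, N.IsPerfectMatching ∧ s(x, y) ∈ N.edgeSet := by
  let N : G.Subgraph :=
    { verts := Set.univ
      Adj := fun a b ↦ (a = x ∧ b = y) ∨ (a = y ∧ b = x) ∨ ∃ ha hb, M.Adj ⟨a, ha⟩ ⟨b, hb⟩
      adj_sub := by
        rintro a b (⟨rfl, rfl⟩ | ⟨rfl, rfl⟩ | ⟨ha, hb, h⟩)
        · exact hxy
        · exact hxy.symm
        · exact h.adj_sub
      edge_vert := fun _ ↦ Set.mem_univ _
      symm := ⟨by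
        rintro a b (h | h | ⟨ha, hb, h⟩)
        · exact .inr (.inl h.symm)
        · exact .inl h.symm
        · exact .inr (.inr ⟨hb, ha, h.symm⟩)⟩ }
  refine ⟨N, ?_, .inl ⟨rfl, rfl⟩⟩
  rw [Subgraph.isPerfectMatching_iff] at hM ⊢
  intro v
  by_cases hvx : v = x
  · subst hvx
    refine ⟨y, .inl ⟨rfl, rfl⟩, ?_⟩
    rintro w (h | h | ⟨ha, hb, h⟩)
    · exact h.2
    · exact absurd h.1 hxy.ne
    · simp at ha
  by_cases hvy : v = y
  · subst hvy
    refine ⟨x, .inr (.inl ⟨rfl, rfl⟩), ?_⟩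
    rintro w (h | h | ⟨ha, hb, h⟩)
    · exact absurd h.1 hxy.ne'
    · exact h.2
    · simp at ha
  obtain ⟨w, hw, huniq⟩ := hM ⟨v, by simp [hvx, hvy]⟩
  refine ⟨w, .inr (.inr ⟨_, w.2, hw⟩), ?_⟩
  rintro z (h | h | ⟨ha, hb, h⟩)
  · exact absurd h.1 hvx
  · exact absurd h.1 hvy
  · exact congrArg Subtype.val (huniq ⟨z, hb⟩ h)

open Finset in
/-- Every edge of a cubic graph without cut vertices lies in a perfect matching. -/
theorem IsCubic.exists_isPerfectMatching_of_adj {V : Type*} [Fintype V] {G : SimpleGraph V}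
    (hG : IsCubic G) (hconn : ∀ v : V, (G.induce ({v}ᶜ : Set V)).Connected) {x y : V}
    (hxy : G.Adj x y) :
    ∃ M : G.Subgraph, M.IsPerfectMatching ∧ s(x, y) ∈ M.edgeSet := by
  classical
  by_contra hcon
  have hfree : (G.induce ({x, y}ᶜ : Set V)).IsMatchingFree :=
    fun M hM ↦ hcon (hM.exists_extend_edge hxy)
  have heven : Even (Fintype.card ({x, y}ᶜ : Set V)) := by
    have h2 : Fintype.card ({x, y}ᶜ : Set V) + 2 = Fintype.card V := by
      rw [← Set.ncard_pair hxy.ne, ← Nat.card_eq_fintype_card, Nat.card_coe_set_eq, add_comm,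
        Set.ncard_add_ncard_compl, Nat.card_eq_fintype_card]
    have := hG.even_card
    grind
  obtain ⟨u, ι, _, K, hcard, hdisj, hKu, hodd, hclosed⟩ := hfree.exists_odd_family heven
  let f : ({x, y}ᶜ : Set V) ↪ V := .subtype _
  have hKS : ∀ i, Disjoint ((K i).map f) (insert x (insert y (u.map f))) := by
    intro i
    rw [Finset.disjoint_left]
    intro a ha
    obtain ⟨z, hz, rfl⟩ := mem_map.mp ha
    have hz2 := z.2
    simp only [Set.mem_compl_iff, Set.mem_insert_iff, Set.mem_singleton_iff, not_or] at hz2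
    simp only [mem_insert, mem_map', not_or]
    exact ⟨hz2.1, hz2.2, Finset.disjoint_left.mp (hKu i) hz⟩
  have hle := hG.three_mul_card_add_two_le (S := insert x (insert y (u.map f)))
    (K := fun i ↦ (K i).map f) (by simp) (by simp) hxy
    (fun i j hij ↦ (disjoint_map f).mpr (hdisj hij)) hKS (fun i ↦ by
      refine (hG.three_le_card_interedges_compl hconn (K := (K i).map f)
        (by simpa using hodd i)).trans (card_le_card ?_)
      rintro ⟨a, b⟩ hab
      simp only [G.mem_interedges_iff, mem_compl] at hab ⊢
      obtain ⟨ha, hb, hab⟩ := hab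
      refine ⟨ha, ?_, hab⟩
      obtain ⟨z, hz, rfl⟩ := mem_map.mp ha
      by_contra hbS
      simp only [mem_insert, not_or] at hbS
      have hbc : b ∈ ({x, y}ᶜ : Set V) := by simp [hbS.1, hbS.2.1]
      obtain h | h := hclosed i z hz ⟨b, hbc⟩ hab
      · exact hb (mem_map_of_mem f h)
      · exact hbS.2.2 (mem_map_of_mem f h))
  have h1 := card_insert_le x (insert y (u.map f))
  have h2 := card_insert_le y (u.map f)
  rw [card_map] at h2
  lia

/-- A vertex set that is a union of edges of a perfect matching has even size. -/
theorem SimpleGraph.Subgraph.IsPerfectMatching.even_ncard {V : Type*} [Finite V]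
    {G : SimpleGraph V} {M : G.Subgraph} (hM : M.IsPerfectMatching) {C : Set V}
    (hC : ∀ a ∈ C, ∀ b, M.Adj a b → b ∈ C) : Even C.ncard := by
  classical
  cases nonempty_fintype V
  have hind : (M.induce C).IsMatching := by
    intro v hv
    obtain ⟨w, hw, huniq⟩ := hM.1 (hM.2 v)
    exact ⟨w, ⟨hv, hC v hv w hw, hw⟩, fun z hz ↦ huniq z hz.2.2⟩
  have h := hind.even_card
  rwa [← Set.ncard_eq_toFinset_card'] at h

/-- A matching covered graph has no cut vertex. -/
theorem IsMatchingCovered.preconnected_induce_compl_singleton {V : Type*} [Finite V]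
    {G : SimpleGraph V} (hG : IsMatchingCovered G) (v : V) :
    (G.induce ({v}ᶜ : Set V)).Preconnected := by
  obtain ⟨hconn, -, hcov⟩ := hG
  intro a b
  by_contra hab
  let C : Set V := Subtype.val '' {z | (G.induce ({v}ᶜ : Set V)).Reachable a z}
  have hvC : v ∉ C := by
    rintro ⟨z, -, hz⟩
    exact z.2 hz
  have hCadj : ∀ c ∈ C, ∀ d, G.Adj c d → d ≠ v → d ∈ C := by
    rintro _ ⟨z, hz, rfl⟩ d hd hdv
    exact ⟨⟨d, hdv⟩, hz.trans (Adj.reachable (G := G.induce ({v}ᶜ : Set V)) hd), rfl⟩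
  have hbC : b.1 ∉ C := by
    rintro ⟨z, hz, hzb⟩
    exact hab (Subtype.ext hzb ▸ hz)
  have haC : a.1 ∈ C := ⟨a, .refl _, rfl⟩
  let D : Set V := (insert v C)ᶜ
  have hvD : v ∉ D := by simp [D]
  have hDadj : ∀ c ∈ D, ∀ d, G.Adj c d → d ≠ v → d ∈ D := by
    intro c hc d hd hdv
    simp only [D, Set.mem_compl_iff, Set.mem_insert_iff, not_or] at hc ⊢
    exact ⟨hdv, fun hdC ↦ hc.2 (hCadj d hdC c hd.symm hc.1)⟩
  have key : ∀ A B : Set V, Disjoint A B → v ∉ A → v ∉ B → A.Nonempty →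
      (∀ c ∈ A, ∀ d, G.Adj c d → d ≠ v → d ∈ A) →
      (∀ c ∈ B, ∀ d, G.Adj c d → d ≠ v → d ∈ B) →
      ∃ M : G.Subgraph, M.IsPerfectMatching ∧ Even B.ncard := by
    intro A B hAB hvA hvB ⟨c, hc⟩ hA hB
    obtain ⟨p, hp, q, hq, hpq⟩ := hconn.preconnected.exists_adj_mem_notMem hc hvA
    obtain rfl : q = v := by
      by_contra hqv
      exact hq (hA p hp q hpq hqv)
    obtain ⟨M, hM, hMe⟩ := hcov s(p, q) hpq
    refine ⟨M, hM, hM.even_ncard fun z hz w hzw ↦ hB z hz w hzw.adj_sub ?_⟩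
    rintro rfl
    have hpz : p = z := (hM.1 (hM.2 w)).unique (Subgraph.Adj.symm hMe) hzw.symm
    exact Set.disjoint_left.mp hAB hp (hpz ▸ hz)
  have hCD : Disjoint C D :=
    Set.disjoint_left.mpr fun z hz hzD ↦ hzD (Set.mem_insert_of_mem _ hz)
  obtain ⟨M, hM, hDe⟩ := key C D hCD hvC hvD ⟨a, haC⟩ hCadj hDadj
  obtain ⟨-, -, hCe⟩ := key D C hCD.symm hvD hvC
    ⟨b, by simpa [D] using ⟨b.2, hbC⟩⟩ hDadj hCadj
  have hVe : Even (Set.univ : Set V).ncard := hM.even_ncard fun _ _ _ _ ↦ Set.mem_univ _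
  have h1 : (insert v C).ncard + D.ncard = Nat.card V := Set.ncard_add_ncard_compl _
  rw [Set.ncard_insert_of_notMem hvC] at h1
  rw [Set.ncard_univ] at hVe
  grind

/-- A cubic graph is matching covered if and only if it is 2-connected. -/
theorem cubic_matchingCovered_iff_twoConnected {V : Type*} [Fintype V]
    (G : SimpleGraph V) (hcubic : IsCubic G) :
    IsMatchingCovered G ↔ IsKConnected 2 G := by
  constructor
  · intro h
    obtain ⟨v₀⟩ := h.1.nonempty
    have hcard : 2 < Nat.card V := by
      have h3 := Set.ncard_le_card (G.neighborSet v₀)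
      rw [hcubic v₀] at h3
      lia
    refine ⟨hcard, fun S hS ↦ ?_⟩
    obtain h0 | h1 : S.ncard = 0 ∨ S.ncard = 1 := by lia
    · rw [Set.ncard_eq_zero] at h0
      rw [h0, Set.compl_empty]
      exact (induceUnivIso G).connected_iff.mpr h.1
    · obtain ⟨v, rfl⟩ := Set.ncard_eq_one.mp h1
      have : Nontrivial V := Finite.one_lt_card_iff_nontrivial.mp (by lia)
      obtain ⟨w, hw⟩ := exists_ne v
      have : Nonempty ({v}ᶜ : Set V) := ⟨⟨w, hw⟩⟩
      exact ⟨h.preconnected_induce_compl_singleton v⟩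
  · rintro ⟨-, h⟩
    have hconn : G.Connected := by
      have h0 := h ∅ (by simp)
      rw [Set.compl_empty] at h0
      exact (induceUnivIso G).connected_iff.mp h0
    refine ⟨hconn, ?_, ?_⟩
    · obtain ⟨v⟩ := hconn.nonempty
      obtain ⟨w, hw⟩ := Set.nonempty_of_ncard_ne_zero (s := G.neighborSet v) (by simp [hcubic v])
      exact ⟨s(v, w), hw⟩
    · intro e he
      induction e with
      | h x y => exact hcubic.exists_isPerfectMatching_of_adj (fun v ↦ h {v} (by simp)) he
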